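/- arXiv:1702.06468 — 2 statements merged into one kernel-verified Lean document; each statement's English description precedes it below -/
import Mathlib

section
/- For every y ∈ C²(cl(B₁); ℝ³) and every r ∈ (0,1], ∫_{∂B_r} |D²y|² dH¹ ≥ (2/r) | ∫_{B_r} Σ_{i=1}^{3} det D²y_i dL² |, where y_i are the components of y. -/
open MeasureTheory Metric Real Filter Matrix
open scoped ENNReal Topology

noncomputable section

/-- The plane `ℝ²` with the Euclidean norm. -/
abbrev E2 : Type := EuclideanSpace ℝ (Fin 2)
/-- The space `ℝ³` with the Euclidean norm. -/
abbrev E3 : Type := EuclideanSpace ℝ (Fin 3)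

/-- The `i`-th standard basis vector of `ℝ²`. -/
def e2 (i : Fin 2) : E2 := EuclideanSpace.single i 1

/-- Partial derivative in the direction of the `i`-th coordinate. -/
def pd (i : Fin 2) (f : E2 → ℝ) (x : E2) : ℝ := fderiv ℝ f x (e2 i)

/-- Hessian matrix of a scalar function on `ℝ²`. -/
def hess (f : E2 → ℝ) (x : E2) : Matrix (Fin 2) (Fin 2) ℝ :=
  Matrix.of fun i j => pd i (pd j f) x

/-- Derivative matrix `Dy ∈ ℝ^{3×2}` of a map `y : ℝ² → ℝ³`. -/
def Dmat (y : E2 → E3) (x : E2) : Matrix (Fin 3) (Fin 2) ℝ :=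
  Matrix.of fun i j => pd j (fun z => y z i) x

/-- Induced metric `g_y = (Dy)ᵀ Dy`. -/
def gmet (y : E2 → E3) (x : E2) : Matrix (Fin 2) (Fin 2) ℝ :=
  (Dmat y x)ᵀ * Dmat y x

/-- The rotated vector `x⊥ = (-x₂, x₁)`. -/
def perpVec (x : E2) : Fin 2 → ℝ := ![-(x 1), x 0]

/-- The unit tangent `x̂⊥ = (-x₂, x₁)/|x|`. -/
def xperpUnit (x : E2) : Fin 2 → ℝ := fun i => perpVec x i / ‖x‖

/-- The reference (cone) metric `g_Δ = Id - Δ² x̂⊥ ⊗ x̂⊥`. -/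
def gDelta (Δ : ℝ) (x : E2) : Matrix (Fin 2) (Fin 2) ℝ :=
  1 - Matrix.of fun i j => (Δ ^ 2 / ‖x‖ ^ 2) * perpVec x i * perpVec x j

/-- Squared Frobenius norm of a matrix. -/
def frob2 {m n : Type*} [Fintype m] [Fintype n] (A : Matrix m n ℝ) : ℝ :=
  ∑ i, ∑ j, (A i j) ^ 2

/-- `|D²y|²`: the sum of the squared Frobenius norms of the Hessians of the components. -/
def hessNormSq (y : E2 → E3) (x : E2) : ℝ :=
  ∑ i : Fin 3, frob2 (hess (fun z => y z i) x)

/-- The free elastic energy `I_{h,Δ}(y)`. -/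
def energy (h Δ : ℝ) (y : E2 → E3) : ℝ :=
  ∫ x in ball (0 : E2) 1, (frob2 (gmet y x - gDelta Δ x) + h ^ 2 * hessNormSq y x)

/-- The singular cone `y^Δ(x) = √(1-Δ²)·(x,0) + Δ|x| e₃`. -/
def coneMap (Δ : ℝ) (x : E2) : E3 :=
  (WithLp.equiv 2 (Fin 3 → ℝ)).symm
    ![Real.sqrt (1 - Δ ^ 2) * x 0, Real.sqrt (1 - Δ ^ 2) * x 1, Δ * ‖x‖]


def gam (ρ θ : ℝ) : E2 := !₂[ρ * cos θ, ρ * sin θ]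

lemma gam_dist {r : ℝ} (hr : 0 < r) (s t : ℝ) :
    dist (gam r s) (gam r t) = 2 * r * |sin ((s - t)/2)| := by
  rw [EuclideanSpace.dist_eq, Real.sqrt_eq_iff_mul_self_eq (by positivity) (by positivity)]
  have h1 : |sin ((s-t)/2)| * |sin ((s-t)/2)| = 1/2 - cos (s - t) / 2 := by
    rw [abs_mul_abs_self, ← sq, Real.sin_sq_eq_half_sub]; ring_nf
  have h2 : (2 * r * |sin ((s - t)/2)|) * (2 * r * |sin ((s - t)/2)|) =
    4 * r^2 * (|sin ((s-t)/2)| * |sin ((s-t)/2)|) := by ring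
  rw [h2, h1, Real.cos_sub]
  simp only [Fin.sum_univ_two, Real.dist_eq, sq_abs, gam]
  simp
  have a1 := Real.sin_sq_add_cos_sq s
  have a2 := Real.sin_sq_add_cos_sq t
  linear_combination r^2 * a1 + r^2 * a2

lemma gam_norm {r : ℝ} (hr : 0 ≤ r) (s : ℝ) : ‖gam r s‖ = r := by
  rw [EuclideanSpace.norm_eq, Real.sqrt_eq_iff_mul_self_eq (by positivity) (by positivity)]
  simp only [Fin.sum_univ_two, Real.norm_eq_abs, sq_abs, gam]
  simp
  linear_combination r^2 * Real.sin_sq_add_cos_sq s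

lemma gam_cont : Continuous fun q : ℝ × ℝ => gam q.1 q.2 := by
  unfold gam; fun_prop

lemma polar_int (D : E2 → ℝ) (hD : Continuous D) {r : ℝ} (hr : 0 < r) :
    ∫ x in ball (0 : E2) r, D x = ∫ ρ in (0:ℝ)..r, ∫ θ in (-π)..π, ρ * D (gam ρ θ) := by
  have e1 := (PiLp.volume_preserving_toLp (Fin 2)).comp
    (volume_preserving_finTwoArrow ℝ).symm
  have me : MeasurableEmbedding (fun q : ℝ × ℝ => (!₂[q.1, q.2] : E2)) := by
    exact ((MeasurableEquiv.toLp 2 (Fin 2 → ℝ)).measurableEmbedding).comp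
      (MeasurableEquiv.finTwoArrow (α := ℝ)).symm.measurableEmbedding
  have mp : MeasurePreserving (fun q : ℝ × ℝ => (!₂[q.1, q.2] : E2)) := e1
  rw [← integral_indicator measurableSet_ball, ← mp.integral_comp me,
    ← integral_comp_polarCoord_symm]
  have hmem : ∀ q : ℝ × ℝ, 0 < q.1 → (gam q.1 q.2 ∈ ball (0:E2) r ↔ q.1 < r) := by
    intro q hq
    rw [mem_ball_zero_iff, gam_norm hq.le]
  have : ∀ q ∈ polarCoord.target, q.1 • (ball (0:E2) r).indicator D
      (!₂[(polarCoord.symm q).1, (polarCoord.symm q).2]) =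
      (Set.Ioo 0 r ×ˢ Set.Ioo (-π) π).indicator (fun q => q.1 * D (gam q.1 q.2)) q := by
    intro q hq
    have hq' : 0 < q.1 ∧ -π < q.2 ∧ q.2 < π := by simpa [polarCoord] using hq
    have hg : (!₂[(polarCoord.symm q).1, (polarCoord.symm q).2] : E2) = gam q.1 q.2 := rfl
    rw [hg]
    by_cases h : q.1 < r
    · rw [Set.indicator_of_mem ((hmem q hq'.1).2 h), Set.indicator_of_mem (by
        simp only [Set.mem_prod, Set.mem_Ioo]; tauto)]
      rfl
    · rw [Set.indicator_of_notMem (fun h' => h ((hmem q hq'.1).1 h')), Set.indicator_of_notMem (by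
        simp only [Set.mem_prod, Set.mem_Ioo]; tauto)]
      simp
  rw [setIntegral_congr_fun polarCoord.open_target.measurableSet this]
  rw [setIntegral_indicator (measurableSet_Ioo.prod measurableSet_Ioo)]
  have hs : polarCoord.target ∩ (Set.Ioo 0 r ×ˢ Set.Ioo (-π) π) = Set.Ioo 0 r ×ˢ Set.Ioo (-π) π := by
    ext q; simp [polarCoord]; tauto
  rw [hs, Measure.volume_eq_prod, setIntegral_prod]
  · rw [intervalIntegral.integral_of_le hr.le, integral_Ioc_eq_integral_Ioo]
    simp_rw [intervalIntegral.integral_of_le (show -π ≤ π by linarith [Real.pi_pos]), integral_Ioc_eq_integral_Ioo]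
  · have hc : Continuous (fun q : ℝ × ℝ => q.1 * D (gam q.1 q.2)) :=
      continuous_fst.mul (hD.comp gam_cont)
    refine IntegrableOn.mono_set (t := Set.Icc 0 r ×ˢ Set.Icc (-π) π) ?_ (Set.prod_mono Set.Ioo_subset_Icc_self Set.Ioo_subset_Icc_self)
    exact hc.continuousOn.integrableOn_compact (isCompact_Icc.prod isCompact_Icc)

lemma gam_anti {r c : ℝ} (hr : 0 < r) (hc : 0 < c) (hcr : c < r) :
    ∃ ε : ℝ, 0 < ε ∧ ∀ s t, |s - t| ≤ π → dist (gam r s) (gam r t) ≤ ε →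
      c * |s - t| ≤ dist (gam r s) (gam r t) := by
  have hpi := Real.pi_pos
  have h1 : 0 < 6 * (1 - c / r) := by
    have : c / r < 1 := (div_lt_one hr).2 hcr
    linarith
  refine ⟨4 * r / π * √(6 * (1 - c / r)), by positivity, fun s t hst hd => ?_⟩
  rw [gam_dist hr] at hd ⊢
  have e : |sin ((s - t)/2)| = sin (|s-t|/2) := by
    rcases abs_cases (s - t) with ⟨h, h'⟩ | ⟨h, h'⟩
    · rw [h, abs_of_nonneg]
      apply sin_nonneg_of_nonneg_of_le_pi <;> linarith
    · rw [h, neg_div, sin_neg, abs_of_nonpos]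
      have : 0 ≤ sin (-((s - t)/2)) := by
        apply sin_nonneg_of_nonneg_of_le_pi <;> linarith
      rw [sin_neg] at this; linarith
  rw [e] at hd ⊢
  obtain ⟨d, hdd⟩ : ∃ d, d = |s-t|/2 := ⟨_, rfl⟩
  have h0 : 0 ≤ d := by rw [hdd]; positivity
  have h2 : d ≤ π/2 := by linarith
  have h3 : |s - t| = 2 * d := by linarith
  rw [← hdd] at hd ⊢
  rw [h3]
  have h4 := Real.mul_le_sin h0 h2
  rcases h0.eq_or_lt with h0 | h0
  · rw [← h0]; simp
  have h5 := Real.sin_gt_sub_cube h0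
  have h6 : d ≤ √(6 * (1 - c / r)) := by
    have : 2 * r * (2 / π * d) ≤ 4 * r / π * √(6 * (1 - c / r)) := le_trans (by gcongr) hd
    have h7 : 2 * r * (2 / π * d) = 4 * r / π * d := by ring
    rw [h7] at this
    exact le_of_mul_le_mul_left this (by positivity)
  have h8 : d^2 ≤ 6 * (1 - c/r) := by
    calc d^2 ≤ (√(6 * (1 - c / r)))^2 := by gcongr
      _ = _ := Real.sq_sqrt h1.le
  have h9 : d * (c / r) ≤ d - d^3/6 := by nlinarith
  have h10 : c * d = r * (d * (c/r)) := by field_simp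
  nlinarith

lemma gam_cont_r (r : ℝ) : Continuous (gam r) := by
  unfold gam; fun_prop

lemma haus_lb {r c : ℝ} (hr : 0 < r) (hc : 0 < c) (hcr : c < r) (J : Set ℝ)
    (hJm : MeasurableSet J) (hJ : ∀ s ∈ J, ∀ t ∈ J, |s - t| ≤ π) :
    ENNReal.ofReal c • Measure.map (gam r) (volume.restrict J) ≤ (μH[1] : Measure E2) := by
  obtain ⟨ε, hε, H⟩ := gam_anti hr hc hcr
  refine Measure.le_hausdorffMeasure _ _ (ENNReal.ofReal ε) (by simpa using hε) ?_
  intro s hs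
  rw [ENNReal.rpow_one]
  refine (measure_mono subset_closure).trans ?_
  rw [← Metric.ediam_closure] at hs ⊢
  rw [Measure.smul_apply, Measure.map_apply (gam_cont_r r).measurable measurableSet_closure,
    Measure.restrict_apply ((gam_cont_r r).measurable measurableSet_closure), smul_eq_mul]
  calc _ ≤ ENNReal.ofReal c * ediam (gam r ⁻¹' closure s ∩ J) := by
        gcongr; exact Real.volume_le_diam _
    _ ≤ ENNReal.ofReal c * (ediam (closure s) / ENNReal.ofReal c) := by
        gcongr
        refine Metric.ediam_le fun x hx y hy => ?_
        rw [ENNReal.le_div_iff_mul_le (by simp [hc]) (by simp)]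
        refine le_trans ?_ (Metric.edist_le_ediam_of_mem hx.1 hy.1)
        have h1 : edist (gam r x) (gam r y) ≤ _ :=
          (Metric.edist_le_ediam_of_mem (s := closure s) hx.1 hy.1).trans hs
        rw [edist_dist, ENNReal.ofReal_le_ofReal_iff hε.le] at h1
        rw [edist_dist, edist_dist, ← ENNReal.ofReal_mul dist_nonneg]
        apply ENNReal.ofReal_le_ofReal
        rw [mul_comm]
        exact H x y (hJ x hx.2 y hy.2) h1
    _ ≤ _ := ENNReal.mul_div_le

lemma gam_surj {r : ℝ} (hr : 0 < r) : sphere (0:E2) r ⊆ gam r '' Set.Icc (-π) π := by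
  intro x hx
  rw [mem_sphere_zero_iff_norm] at hx
  refine ⟨Complex.arg ⟨x 0, x 1⟩, ⟨(Complex.neg_pi_lt_arg _).le, Complex.arg_le_pi _⟩, ?_⟩
  have hn : ‖(⟨x 0, x 1⟩ : ℂ)‖ = r := by
    rw [← hx, EuclideanSpace.norm_eq, Complex.norm_def, Complex.normSq_apply]
    simp [Fin.sum_univ_two, sq]
  have h1 := Complex.norm_mul_cos_arg ⟨x 0, x 1⟩
  have h2 := Complex.norm_mul_sin_arg ⟨x 0, x 1⟩
  rw [hn] at h1 h2
  ext i; fin_cases i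
  · simpa [gam] using h1
  · simpa [gam] using h2

lemma sphere_fin {r : ℝ} (hr : 0 < r) : (μH[1] : Measure E2) (sphere (0:E2) r) < ∞ := by
  refine (measure_mono (gam_surj hr)).trans_lt ?_
  have hl : LipschitzWith r.toNNReal (gam r) := by
    apply LipschitzWith.of_dist_le_mul
    intro s t
    rw [gam_dist hr, Real.coe_toNNReal _ hr.le, Real.dist_eq]
    have := Real.abs_sin_le_abs (x := (s - t)/2)
    rw [abs_div, abs_two] at this
    nlinarith
  refine (hl.hausdorffMeasure_image_le zero_le_one _).trans_lt ?_
  rw [hausdorffMeasure_real]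
  simp [ENNReal.mul_lt_top_iff]

lemma haus_half {r c : ℝ} (hr : 0 < r) (hc : 0 < c) (hcr : c < r) (J : Set ℝ)
    (hJm : MeasurableSet J) (hJ : ∀ s ∈ J, ∀ t ∈ J, |s - t| ≤ π) (C : Set E2)
    (hCm : MeasurableSet C) (hC : C ⊆ sphere (0:E2) r) (hJC : ∀ s ∈ J, gam r s ∈ C)
    (g : E2 → ℝ) (hg : Continuous g) (hg0 : ∀ x, 0 ≤ g x) :
    c * ∫ θ in J, g (gam r θ) ≤ ∫ x in C, g x ∂μH[1] := by
  have h := Measure.restrict_mono (le_refl C) (haus_lb hr hc hcr J hJm hJ)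
  have e : (ENNReal.ofReal c • Measure.map (gam r) (volume.restrict J)).restrict C =
      ENNReal.ofReal c • Measure.map (gam r) (volume.restrict J) := by
    rw [Measure.restrict_smul, Measure.restrict_map (gam_cont_r r).measurable hCm,
      Measure.restrict_restrict ((gam_cont_r r).measurable hCm),
      Set.inter_eq_right.2 (show J ⊆ gam r ⁻¹' C from hJC)]
  rw [e] at h
  have hi : IntegrableOn g C (μH[1] : Measure E2) := by
    refine IntegrableOn.mono_set ?_ hC
    obtain ⟨M, hM⟩ := (isCompact_sphere (0:E2) r).exists_bound_of_continuousOn hg.continuousOn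
    exact Measure.integrableOn_of_bounded (sphere_fin hr).ne hg.aestronglyMeasurable
      (M := M) ((ae_restrict_iff' isClosed_sphere.measurableSet).2 (Eventually.of_forall hM))
  have h2 := integral_mono_measure h (Eventually.of_forall hg0) hi
  rwa [integral_smul_measure, integral_map (gam_cont_r r).aemeasurable hg.aestronglyMeasurable,
    ENNReal.toReal_ofReal hc.le, smul_eq_mul] at h2

lemma haus_main {r : ℝ} (hr : 0 < r) (g : E2 → ℝ) (hg : Continuous g) (hg0 : ∀ x, 0 ≤ g x) :
    r * ∫ θ in (-π)..π, g (gam r θ) ≤ ∫ x in sphere (0:E2) r, g x ∂μH[1] := by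
  have hpi := Real.pi_pos
  have hi : IntegrableOn g (sphere (0:E2) r) (μH[1] : Measure E2) := by
    obtain ⟨M, hM⟩ := (isCompact_sphere (0:E2) r).exists_bound_of_continuousOn hg.continuousOn
    exact Measure.integrableOn_of_bounded (sphere_fin hr).ne hg.aestronglyMeasurable
      (M := M) ((ae_restrict_iff' isClosed_sphere.measurableSet).2 (Eventually.of_forall hM))
  have hgc : Continuous fun θ => g (gam r θ) := hg.comp (gam_cont_r r)
  have hm1 : MeasurableSet {x : E2 | x 1 < 0} :=
    (isOpen_lt (by fun_prop) continuous_const).measurableSet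
  have hm2 : MeasurableSet {x : E2 | 0 < x 1} :=
    (isOpen_lt continuous_const (by fun_prop)).measurableSet
  set C1 : Set E2 := sphere (0:E2) r ∩ {x | x 1 < 0}
  set C2 : Set E2 := sphere (0:E2) r ∩ {x | 0 < x 1}
  have hC1 : MeasurableSet C1 := isClosed_sphere.measurableSet.inter hm1
  have hC2 : MeasurableSet C2 := isClosed_sphere.measurableSet.inter hm2
  have hsum : ∫ x in C1, g x ∂μH[1] + ∫ x in C2, g x ∂μH[1] ≤
      ∫ x in sphere (0:E2) r, g x ∂μH[1] := by
    rw [← setIntegral_union (by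
      rw [Set.disjoint_left]; rintro x ⟨_, h1⟩ ⟨_, h2⟩; exact lt_asymm (show x 1 < 0 from h1) h2) hC2
      (hi.mono_set Set.inter_subset_left) (hi.mono_set Set.inter_subset_left)]
    exact setIntegral_mono_set hi (Eventually.of_forall hg0)
      (Set.union_subset Set.inter_subset_left Set.inter_subset_left).eventuallyLE
  have hmain : ∀ c, 0 < c → c < r → c * ∫ θ in (-π)..π, g (gam r θ) ≤
      ∫ x in sphere (0:E2) r, g x ∂μH[1] := by
    intro c hc hcr
    have h1 := haus_half hr hc hcr (Set.Ioo (-π) 0) measurableSet_Ioo (by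
      rintro s ⟨hs, hs'⟩ t ⟨ht, ht'⟩; rw [abs_le]; constructor <;> linarith) C1 hC1
      Set.inter_subset_left (by
        rintro s ⟨hs, hs'⟩
        refine ⟨by rw [mem_sphere_zero_iff_norm, gam_norm hr.le], ?_⟩
        have := sin_neg_of_neg_of_neg_pi_lt hs' hs
        simp only [gam, Set.mem_ofPred_eq]
        simp
        nlinarith) g hg hg0
    have h2 := haus_half hr hc hcr (Set.Ioo 0 π) measurableSet_Ioo (by
      rintro s ⟨hs, hs'⟩ t ⟨ht, ht'⟩; rw [abs_le]; constructor <;> linarith) C2 hC2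
      Set.inter_subset_left (by
        rintro s ⟨hs, hs'⟩
        refine ⟨by rw [mem_sphere_zero_iff_norm, gam_norm hr.le], ?_⟩
        have := sin_pos_of_pos_of_lt_pi hs hs'
        simp only [gam, Set.mem_ofPred_eq]
        simp
        positivity) g hg hg0
    rw [← intervalIntegral.integral_add_adjacent_intervals (hgc.intervalIntegrable (-π) 0)
      (hgc.intervalIntegrable 0 π), intervalIntegral.integral_of_le (by linarith),
      intervalIntegral.integral_of_le hpi.le, integral_Ioc_eq_integral_Ioo,
      integral_Ioc_eq_integral_Ioo]
    linarith
  have ht : Tendsto (fun c => c * ∫ θ in (-π)..π, g (gam r θ)) (𝓝[<] r)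
      (𝓝 (r * ∫ θ in (-π)..π, g (gam r θ))) := by
    apply Tendsto.mono_left _ nhdsWithin_le_nhds
    exact (continuous_id.mul continuous_const).tendsto r
  refine le_of_tendsto ht ?_
  filter_upwards [Ioo_mem_nhdsLT hr] with c hc
  exact hmain c hc.1 hc.2

lemma wirt {p p' : ℝ → ℝ} (hp : ∀ x, HasDerivAt p (p' x) x) (hc : Continuous p')
    (hper : p (-π) = p π) (hm : ∫ x in (-π)..π, p x = 0) :
    ∫ x in (-π)..π, (p x)^2 ≤ ∫ x in (-π)..π, (p' x)^2 := by
  have hab : -π < π := by linarith [Real.pi_pos]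
  have hpc : Continuous p := continuous_iff_continuousAt.2 fun x => (hp x).continuousAt
  have mem : ∀ g : ℝ → ℝ, Continuous g →
      MemLp (fun x => (g x : ℂ)) 2 (volume.restrict (Set.Ioc (-π) π)) := by
    intro g hg
    have h1 : Continuous (fun x => (g x : ℂ)) := Complex.continuous_ofReal.comp hg
    refine MemLp.mono_measure (Measure.restrict_mono Set.Ioc_subset_Icc_self le_rfl) ?_
    rw [memLp_two_iff_integrable_sq_norm h1.aestronglyMeasurable]
    exact (h1.norm.pow 2).continuousOn.integrableOn_compact isCompact_Icc
  have h1 := hasSum_sq_fourierCoeffOn hab (mem p hpc)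
  have h2 := hasSum_sq_fourierCoeffOn hab (mem p' hc)
  have key : ∀ n : ℤ, ‖fourierCoeffOn hab (fun x => (p x : ℂ)) n‖ ^ 2 ≤
      ‖fourierCoeffOn hab (fun x => (p' x : ℂ)) n‖ ^ 2 := by
    intro n
    by_cases hn : n = 0
    · subst hn
      have : fourierCoeffOn hab (fun x => (p x : ℂ)) 0 = 0 := by
        rw [fourierCoeffOn_eq_integral]
        simp [intervalIntegral.integral_ofReal, hm]
      rw [this]; simp
    · have h := fourierCoeffOn_of_hasDerivAt hab hn (f := fun x => (p x : ℂ))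
        (f' := fun x => (p' x : ℂ)) (fun x _ => (hp x).ofReal_comp)
        ((Complex.continuous_ofReal.comp hc).intervalIntegrable _ _)
      rw [h, hper]
      have hn1 : (1:ℝ) ≤ |(n:ℝ)| := by
        exact_mod_cast Int.one_le_abs hn
      gcongr
      have e : (1 / (-2 * (π:ℂ) * Complex.I * n) *
        (fourier (-n) ((-π : ℝ) : AddCircle (π - -π)) * ((p π : ℂ) - (p π : ℂ)) -
          (((π : ℝ):ℂ) - ((-π:ℝ):ℂ)) * fourierCoeffOn hab (fun x => (p' x : ℂ)) n)) =
          (1 / (Complex.I * n)) * fourierCoeffOn hab (fun x => (p' x : ℂ)) n := by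
        have : (π : ℂ) ≠ 0 := by exact_mod_cast Real.pi_ne_zero
        have : (n : ℂ) ≠ 0 := by exact_mod_cast hn
        push_cast
        field_simp
        ring
      rw [e, norm_mul]
      apply mul_le_of_le_one_left (norm_nonneg _)
      simp only [norm_div, norm_mul, Complex.norm_I, one_mul, norm_one, Complex.norm_intCast]
      rw [div_le_one (by linarith)]
      exact hn1
  have h3 := hasSum_le key h1 h2
  simp only [smul_eq_mul, Complex.norm_real, Real.norm_eq_abs, sq_abs] at h3
  have : 0 < (π - -π)⁻¹ := by have := Real.pi_pos; positivity
  exact le_of_mul_le_mul_left h3 (by simpa using this)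

lemma slope_bound {p p' : ℝ → ℝ} {σ C ρ : ℝ} (hρ : ρ ∈ Set.Icc (σ-1) (σ+1))
    (h : ∀ x, HasDerivAt p (p' x) x) (hC : ∀ x ∈ Set.Icc (σ-1) (σ+1), |p' x| ≤ C) :
    |slope p σ ρ| ≤ C := by
  have h0 : 0 ≤ C := (abs_nonneg _).trans (hC ρ hρ)
  have := Convex.norm_image_sub_le_of_norm_hasDerivWithin_le (f := p) (f' := p') (C := C)
    (s := Set.Icc (σ-1) (σ+1)) (x := σ) (y := ρ) (fun x _ => (h x).hasDerivWithinAt) hC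
    (convex_Icc _ _) (by constructor <;> linarith) hρ
  rw [slope_def_field, abs_div]
  exact div_le_of_le_mul₀ (abs_nonneg _) h0 this

lemma area_deriv {p q pr qr pt qt : ℝ → ℝ → ℝ}
    (hp : Continuous p.uncurry) (hq : Continuous q.uncurry)
    (hpr : Continuous pr.uncurry) (hqr : Continuous qr.uncurry)
    (hpt : Continuous pt.uncurry) (hqt : Continuous qt.uncurry)
    (dpr : ∀ ρ θ, HasDerivAt (fun x => p x θ) (pr ρ θ) ρ)
    (dqr : ∀ ρ θ, HasDerivAt (fun x => q x θ) (qr ρ θ) ρ)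
    (dpt : ∀ ρ θ, HasDerivAt (p ρ) (pt ρ θ) θ)
    (dqt : ∀ ρ θ, HasDerivAt (q ρ) (qt ρ θ) θ)
    (pp : ∀ ρ, p ρ (-π) = p ρ π) (qp : ∀ ρ, q ρ (-π) = q ρ π) (σ : ℝ) :
    HasDerivAt (fun ρ => ∫ θ in (-π)..π, p ρ θ * qt ρ θ)
      (∫ θ in (-π)..π, (pr σ θ * qt σ θ - pt σ θ * qr σ θ)) σ := by
  have sec : ∀ {f : ℝ → ℝ → ℝ}, Continuous f.uncurry → ∀ ρ, Continuous (f ρ) :=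
    fun hf ρ => hf.comp (by fun_prop : Continuous fun θ : ℝ => (ρ, θ))
  have sec' : ∀ {f : ℝ → ℝ → ℝ}, Continuous f.uncurry → ∀ θ, Continuous (fun ρ => f ρ θ) :=
    fun hf θ => hf.comp (by fun_prop : Continuous fun ρ : ℝ => (ρ, θ))
  rw [hasDerivAt_iff_tendsto_slope]
  have key : ∀ ρ, slope (fun ρ => ∫ θ in (-π)..π, p ρ θ * qt ρ θ) σ ρ =
      ∫ θ in (-π)..π, (slope (fun x => p x θ) σ ρ * qt ρ θ -
        pt σ θ * slope (fun x => q x θ) σ ρ) := by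
    intro ρ
    have ibp := intervalIntegral.integral_mul_deriv_eq_deriv_mul (a := -π) (b := π)
      (u := p σ) (u' := pt σ) (v := fun θ => q ρ θ - q σ θ) (v' := fun θ => qt ρ θ - qt σ θ)
      (fun θ _ => dpt σ θ) (fun θ _ => (dqt ρ θ).sub (dqt σ θ))
      ((sec hpt σ).intervalIntegrable _ _)
      (((sec hqt ρ).sub (sec hqt σ)).intervalIntegrable _ _)
    rw [pp, qp, qp, sub_self, zero_sub] at ibp
    have e1 : ∀ θ, slope (fun x => p x θ) σ ρ * qt ρ θ -
        pt σ θ * slope (fun x => q x θ) σ ρ =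
        (ρ - σ)⁻¹ * ((p ρ θ - p σ θ) * qt ρ θ - pt σ θ * (q ρ θ - q σ θ)) := by
      intro θ; simp only [slope_def_field]; ring
    simp_rw [e1]
    rw [intervalIntegral.integral_const_mul, slope_def_field, div_eq_inv_mul]
    congr 1
    rw [intervalIntegral.integral_sub, sub_eq_add_neg _ (∫ θ in (-π)..π, pt σ θ * (q ρ θ - q σ θ)),
      ← ibp, ← intervalIntegral.integral_sub, ← intervalIntegral.integral_add]
    · congr 1; ext θ; ring
    all_goals
      apply Continuous.intervalIntegrable
      have a1 := sec hp ρ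
      have a2 := sec hp σ
      have a3 := sec hq ρ
      have a4 := sec hq σ
      have a5 := sec hqt ρ
      have a6 := sec hqt σ
      have a7 := sec hpt σ
      fun_prop
  simp_rw [funext key]
  have bd : ∀ {f : ℝ → ℝ → ℝ}, Continuous f.uncurry → ∃ C, ∀ ρ ∈ Set.Icc (σ-1) (σ+1),
      ∀ θ ∈ Set.Icc (-π) π, |f ρ θ| ≤ C := by
    intro f hf
    obtain ⟨C, hC⟩ := (isCompact_Icc.prod isCompact_Icc).exists_bound_of_continuousOn
      (s := Set.Icc (σ-1) (σ+1) ×ˢ Set.Icc (-π) π) hf.continuousOn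
    exact ⟨C, fun ρ hρ θ hθ => hC (ρ, θ) ⟨hρ, hθ⟩⟩
  obtain ⟨C1, h1⟩ := bd hpr
  obtain ⟨C2, h2⟩ := bd hqr
  obtain ⟨C3, h3⟩ := bd hpt
  obtain ⟨C4, h4⟩ := bd hqt
  refine intervalIntegral.tendsto_integral_filter_of_dominated_convergence
    (fun _ => C1 * C4 + C3 * C2) ?_ ?_ ?_ ?_
  · refine Eventually.of_forall fun ρ => Continuous.aestronglyMeasurable ?_
    simp only [slope_def_field]
    have a1 := sec hp ρ
    have a2 := sec hp σ
    have a3 := sec hq ρ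
    have a4 := sec hq σ
    have a5 := sec hqt ρ
    have a7 := sec hpt σ
    fun_prop
  · have : Set.Icc (σ-1) (σ+1) ∈ 𝓝[≠] σ :=
      mem_nhdsWithin_of_mem_nhds (Icc_mem_nhds (by linarith) (by linarith))
    filter_upwards [this] with ρ hρ
    refine Eventually.of_forall fun θ hθ => ?_
    rw [Set.uIoc_of_le (by linarith [Real.pi_pos])] at hθ
    have hθ' : θ ∈ Set.Icc (-π) π := Set.Ioc_subset_Icc_self hθ
    have hσ : σ ∈ Set.Icc (σ-1) (σ+1) := by constructor <;> linarith
    have b1 := slope_bound hρ (fun x => dpr x θ) (fun x hx => h1 x hx θ hθ')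
    have b2 := slope_bound hρ (fun x => dqr x θ) (fun x hx => h2 x hx θ hθ')
    refine (norm_sub_le _ _).trans ?_
    rw [norm_mul, norm_mul]
    have := h3 σ hσ θ hθ'
    have := h4 ρ hρ θ hθ'
    simp only [Real.norm_eq_abs]
    have := abs_nonneg (slope (fun x => p x θ) σ ρ)
    have := abs_nonneg (pt σ θ)
    gcongr <;> linarith
  · exact intervalIntegrable_const
  · refine Eventually.of_forall fun θ _ => ?_
    have t1 := hasDerivAt_iff_tendsto_slope.1 (dpr σ θ)
    have t2 := hasDerivAt_iff_tendsto_slope.1 (dqr σ θ)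
    have t3 : Tendsto (fun ρ => qt ρ θ) (𝓝[≠] σ) (𝓝 (qt σ θ)) :=
      ((sec' hqt θ).tendsto σ).mono_left nhdsWithin_le_nhds
    exact (t1.mul t3).sub (t2.const_mul _)

lemma gam_eq (ρ θ : ℝ) : gam ρ θ = (ρ * cos θ) • e2 0 + (ρ * sin θ) • e2 1 := by
  ext i; fin_cases i <;> simp [gam, e2]

lemma pd_cont {a : E2 → ℝ} (ha : ContDiff ℝ 1 a) (i : Fin 2) : Continuous (pd i a) := by
  unfold pd
  exact (ha.continuous_fderiv (by norm_num)).clm_apply continuous_const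

def rdv (a : E2 → ℝ) (ρ θ : ℝ) : ℝ := cos θ * pd 0 a (gam ρ θ) + sin θ * pd 1 a (gam ρ θ)
def tdv (a : E2 → ℝ) (ρ θ : ℝ) : ℝ :=
  ρ * (-sin θ * pd 0 a (gam ρ θ) + cos θ * pd 1 a (gam ρ θ))

lemma rdv_cont {a : E2 → ℝ} (ha : ContDiff ℝ 1 a) : Continuous (rdv a).uncurry := by
  have h0 := (pd_cont ha 0).comp gam_cont
  have h1 := (pd_cont ha 1).comp gam_cont
  have e : (rdv a).uncurry = fun q : ℝ × ℝ => cos q.2 * (pd 0 a ∘ fun q : ℝ × ℝ => gam q.1 q.2) q +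
    sin q.2 * (pd 1 a ∘ fun q : ℝ × ℝ => gam q.1 q.2) q := rfl
  rw [e]; fun_prop

lemma tdv_cont {a : E2 → ℝ} (ha : ContDiff ℝ 1 a) : Continuous (tdv a).uncurry := by
  have h0 := (pd_cont ha 0).comp gam_cont
  have h1 := (pd_cont ha 1).comp gam_cont
  have e : (tdv a).uncurry = fun q : ℝ × ℝ => q.1 * (-sin q.2 * (pd 0 a ∘ fun q : ℝ × ℝ => gam q.1 q.2) q +
    cos q.2 * (pd 1 a ∘ fun q : ℝ × ℝ => gam q.1 q.2) q) := rfl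
  rw [e]; fun_prop

lemma rdv_deriv {a : E2 → ℝ} (ha : ContDiff ℝ 1 a) (ρ θ : ℝ) :
    HasDerivAt (fun x => a (gam x θ)) (rdv a ρ θ) ρ := by
  have h := (ha.differentiable (by norm_num) (gam ρ θ)).hasFDerivAt
  have g : HasDerivAt (fun x => gam x θ) (cos θ • e2 0 + sin θ • e2 1) ρ := by
    simp only [gam_eq]
    have h1 := (((hasDerivAt_id ρ).mul_const (cos θ)).smul_const (e2 0)).add
      (((hasDerivAt_id ρ).mul_const (sin θ)).smul_const (e2 1))
    simp only [id, one_mul] at h1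
    exact h1
  have e : rdv a ρ θ = fderiv ℝ a (gam ρ θ) (cos θ • e2 0 + sin θ • e2 1) := by
    rw [map_add, map_smul, map_smul]; rfl
  rw [e]
  exact h.comp_hasDerivAt ρ g

lemma tdv_deriv {a : E2 → ℝ} (ha : ContDiff ℝ 1 a) (ρ θ : ℝ) :
    HasDerivAt (fun x => a (gam ρ x)) (tdv a ρ θ) θ := by
  have h := (ha.differentiable (by norm_num) (gam ρ θ)).hasFDerivAt
  have g : HasDerivAt (fun x => gam ρ x) ((ρ * -sin θ) • e2 0 + (ρ * cos θ) • e2 1) θ := by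
    simp only [gam_eq]
    exact (((hasDerivAt_cos θ).const_mul ρ).smul_const (e2 0)).add
      (((hasDerivAt_sin θ).const_mul ρ).smul_const (e2 1))
  have e : tdv a ρ θ = fderiv ℝ a (gam ρ θ) ((ρ * -sin θ) • e2 0 + (ρ * cos θ) • e2 1) := by
    rw [map_add, map_smul, map_smul]; simp only [tdv, pd, smul_eq_mul]; ring
  rw [e]
  exact h.comp_hasDerivAt θ g

lemma gam_per (ρ : ℝ) : gam ρ (-π) = gam ρ π := by simp [gam]

lemma det_cont {a b : E2 → ℝ} (ha : ContDiff ℝ 1 a) (hb : ContDiff ℝ 1 b) :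
    Continuous fun x => pd 0 a x * pd 1 b x - pd 0 b x * pd 1 a x := by
  have := pd_cont ha 0
  have := pd_cont ha 1
  have := pd_cont hb 0
  have := pd_cont hb 1
  fun_prop

lemma green {a b : E2 → ℝ} (ha : ContDiff ℝ 1 a) (hb : ContDiff ℝ 1 b) {r : ℝ} (hr : 0 < r) :
    ∫ x in ball (0:E2) r, (pd 0 a x * pd 1 b x - pd 0 b x * pd 1 a x) =
      ∫ θ in (-π)..π, a (gam r θ) * tdv b r θ := by
  have hD := det_cont ha hb
  rw [polar_int _ hD hr]
  have e : ∀ ρ θ : ℝ, ρ * (pd 0 a (gam ρ θ) * pd 1 b (gam ρ θ) - pd 0 b (gam ρ θ) * pd 1 a (gam ρ θ))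
      = rdv a ρ θ * tdv b ρ θ - tdv a ρ θ * rdv b ρ θ := by
    intro ρ θ
    simp only [rdv, tdv]
    linear_combination (-ρ * (pd 0 a (gam ρ θ) * pd 1 b (gam ρ θ) -
      pd 0 b (gam ρ θ) * pd 1 a (gam ρ θ))) * Real.sin_sq_add_cos_sq θ
  simp only [e]
  have hd := area_deriv (p := fun ρ θ => a (gam ρ θ)) (q := fun ρ θ => b (gam ρ θ))
    (ha.continuous.comp gam_cont) (hb.continuous.comp gam_cont) (rdv_cont ha) (rdv_cont hb)
    (tdv_cont ha) (tdv_cont hb) (rdv_deriv ha) (rdv_deriv hb) (tdv_deriv ha) (tdv_deriv hb)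
    (fun ρ => by simp only [gam_per]) (fun ρ => by simp only [gam_per])
  have hc : Continuous fun ρ => ∫ θ in (-π)..π, (rdv a ρ θ * tdv b ρ θ - tdv a ρ θ * rdv b ρ θ) := by
    apply intervalIntegral.continuous_parametric_intervalIntegral_of_continuous'
    exact ((rdv_cont ha).mul (tdv_cont hb)).sub ((tdv_cont ha).mul (rdv_cont hb))
  rw [intervalIntegral.integral_eq_sub_of_hasDerivAt (fun ρ _ => hd ρ) (hc.intervalIntegrable _ _)]
  simp [tdv]

lemma scalar_bound {a b : E2 → ℝ} (ha : ContDiff ℝ 1 a) (hb : ContDiff ℝ 1 b) {r : ℝ} (hr : 0 < r) :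
    |∫ x in ball (0:E2) r, (pd 0 a x * pd 1 b x - pd 0 b x * pd 1 a x)| ≤
      r^2 / 2 * ∫ θ in (-π)..π, (fun x => pd 0 a x ^ 2 + pd 1 a x ^ 2 + (pd 0 b x ^ 2 + pd 1 b x ^ 2))
        (gam r θ) := by
  rw [green ha hb hr]
  have hpi := Real.pi_pos
  have ca : Continuous fun θ => a (gam r θ) := ha.continuous.comp (gam_cont_r r)
  have cta : Continuous (tdv a r) := (tdv_cont ha).comp (by fun_prop : Continuous fun θ : ℝ => (r, θ))
  have ctb : Continuous (tdv b r) := (tdv_cont hb).comp (by fun_prop : Continuous fun θ : ℝ => (r, θ))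
  set m : ℝ := (2 * π)⁻¹ * ∫ θ in (-π)..π, a (gam r θ) with hm
  have hb0 : ∫ θ in (-π)..π, tdv b r θ = 0 := by
    rw [intervalIntegral.integral_eq_sub_of_hasDerivAt (fun θ _ => tdv_deriv hb r θ)
      (ctb.intervalIntegrable _ _), gam_per, sub_self]
  have h1 : ∫ θ in (-π)..π, a (gam r θ) * tdv b r θ =
      ∫ θ in (-π)..π, (a (gam r θ) - m) * tdv b r θ := by
    simp only [sub_mul]
    rw [intervalIntegral.integral_sub, intervalIntegral.integral_const_mul, hb0]
    · simp
    · exact (ca.mul ctb).intervalIntegrable _ _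
    · exact (continuous_const.mul ctb).intervalIntegrable _ _
  have hw := wirt (p := fun θ => a (gam r θ) - m) (p' := tdv a r)
    (fun θ => (tdv_deriv ha r θ).sub_const m) cta (by simp only [gam_per]) (by
      rw [intervalIntegral.integral_sub (ca.intervalIntegrable _ _) intervalIntegrable_const,
        intervalIntegral.integral_const, hm, smul_eq_mul]
      field_simp
      ring)
  rw [h1]
  have i1 : IntervalIntegrable (fun θ => (a (gam r θ) - m)^2) volume (-π) π :=
    ((ca.sub continuous_const).pow 2).intervalIntegrable _ _
  have i2 : IntervalIntegrable (fun θ => (tdv a r θ)^2) volume (-π) π :=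
    Continuous.intervalIntegrable (by fun_prop) _ _
  have i3 : IntervalIntegrable (fun θ => (tdv b r θ)^2) volume (-π) π :=
    Continuous.intervalIntegrable (by fun_prop) _ _
  have cg : Continuous (fun θ => (fun x => pd 0 a x ^ 2 + pd 1 a x ^ 2 + (pd 0 b x ^ 2 + pd 1 b x ^ 2))
        (gam r θ)) := by
    have := (pd_cont ha 0).comp (gam_cont_r r)
    have := (pd_cont ha 1).comp (gam_cont_r r)
    have := (pd_cont hb 0).comp (gam_cont_r r)
    have := (pd_cont hb 1).comp (gam_cont_r r)
    simp only [Function.comp_def] at *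
    fun_prop
  calc |∫ θ in (-π)..π, (a (gam r θ) - m) * tdv b r θ|
      ≤ ∫ θ in (-π)..π, |(a (gam r θ) - m) * tdv b r θ| :=
        intervalIntegral.abs_integral_le_integral_abs (by linarith)
    _ ≤ ∫ θ in (-π)..π, (1/2) * ((a (gam r θ) - m)^2 + (tdv b r θ)^2) := by
        apply intervalIntegral.integral_mono (by linarith)
        · exact ((ca.sub continuous_const).mul ctb).abs.intervalIntegrable _ _
        · exact (i1.add i3).const_mul _
        · intro θ
          simp only [abs_mul]
          have := two_mul_le_add_sq |a (gam r θ) - m| |tdv b r θ|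
          simp only [sq_abs] at this
          linarith
    _ = (1/2) * ((∫ θ in (-π)..π, (a (gam r θ) - m)^2) + ∫ θ in (-π)..π, (tdv b r θ)^2) := by
        rw [intervalIntegral.integral_const_mul, intervalIntegral.integral_add i1 i3]
    _ ≤ (1/2) * ((∫ θ in (-π)..π, (tdv a r θ)^2) + ∫ θ in (-π)..π, (tdv b r θ)^2) := by
        gcongr
    _ = ∫ θ in (-π)..π, (1/2) * ((tdv a r θ)^2 + (tdv b r θ)^2) := by
        rw [intervalIntegral.integral_const_mul, intervalIntegral.integral_add i2 i3]
    _ ≤ ∫ θ in (-π)..π, r^2/2 * (fun x => pd 0 a x ^ 2 + pd 1 a x ^ 2 + (pd 0 b x ^ 2 + pd 1 b x ^ 2))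
        (gam r θ) := by
        apply intervalIntegral.integral_mono (by linarith)
        · exact (i2.add i3).const_mul _
        · exact (cg.intervalIntegrable _ _).const_mul _
        · intro θ
          have aux : ∀ u v : ℝ, (-sin θ * u + cos θ * v)^2 ≤ u^2 + v^2 := by
            intro u v
            have h := Real.sin_sq_add_cos_sq θ
            have : u^2+v^2 - (-sin θ * u + cos θ * v)^2 = (cos θ * u + sin θ * v)^2 := by
              linear_combination (-(u^2+v^2)) * h
            nlinarith [sq_nonneg (cos θ * u + sin θ * v)]
          simp only [tdv, mul_pow]
          have k1 := aux (pd 0 a (gam r θ)) (pd 1 a (gam r θ))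
          have k2 := aux (pd 0 b (gam r θ)) (pd 1 b (gam r θ))
          have := mul_le_mul_of_nonneg_left (add_le_add k1 k2) (by positivity : 0 ≤ r^2/2)
          linarith
    _ = _ := by rw [intervalIntegral.integral_const_mul]

/-- boundary integral bound for `|D²y|²` via the Hessian determinants. -/
theorem stmt_6 (y : E2 → E3) (hy : ContDiff ℝ 2 y) (r : ℝ) (hr : r ∈ Set.Ioc (0 : ℝ) 1) :
    (2 / r) * |∫ x in ball (0 : E2) r, ∑ i : Fin 3, (hess (fun z => y z i) x).det| ≤
      ∫ x in sphere (0 : E2) r, hessNormSq y x ∂μH[1] := by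
  have hr0 : 0 < r := hr.1
  have hyi : ∀ i, ContDiff ℝ 2 (fun z => y z i) := fun i => (contDiff_euclidean.1 hy) i
  have hpd : ∀ i j, ContDiff ℝ 1 (pd j (fun z => y z i)) := by
    intro i j
    unfold pd
    exact ((hyi i).fderiv_right (by norm_num)).clm_apply contDiff_const
  set a := fun i => pd 0 (fun z => y z i)
  set b := fun i => pd 1 (fun z => y z i)
  have ha : ∀ i, ContDiff ℝ 1 (a i) := fun i => hpd i 0
  have hb : ∀ i, ContDiff ℝ 1 (b i) := fun i => hpd i 1
  set G : Fin 3 → E2 → ℝ := fun i x =>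
    pd 0 (a i) x ^ 2 + pd 1 (a i) x ^ 2 + (pd 0 (b i) x ^ 2 + pd 1 (b i) x ^ 2)
  have hG : ∀ i, Continuous (G i) := by
    intro i
    have := pd_cont (ha i) 0
    have := pd_cont (ha i) 1
    have := pd_cont (hb i) 0
    have := pd_cont (hb i) 1
    fun_prop
  have hdet : ∀ x i, (hess (fun z => y z i) x).det =
      pd 0 (a i) x * pd 1 (b i) x - pd 0 (b i) x * pd 1 (a i) x := by
    intro x i; rw [Matrix.det_fin_two]; rfl
  have hfrob : ∀ x, hessNormSq y x = ∑ i, G i x := by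
    intro x
    unfold hessNormSq
    refine Finset.sum_congr rfl fun i _ => ?_
    simp only [frob2, Fin.sum_univ_two, G, hess, Matrix.of_apply, a, b]
    ring
  simp only [hdet, hfrob]
  have hGs : Continuous fun x => ∑ i, G i x := continuous_finsetSum _ fun i _ => hG i
  have hH := haus_main hr0 (fun x => ∑ i, G i x) hGs
    (fun x => Finset.sum_nonneg fun i _ => by simp only [G]; positivity)
  have hint : ∀ i ∈ Finset.univ, Integrable (fun x => pd 0 (a i) x * pd 1 (b i) x - pd 0 (b i) x * pd 1 (a i) x)
      (volume.restrict (ball (0:E2) r)) := by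
    intro i _
    exact ((det_cont (ha i) (hb i)).continuousOn.integrableOn_compact
      (isCompact_closedBall (0:E2) r)).mono_set ball_subset_closedBall
  rw [integral_finsetSum _ hint]
  have hcompi : ∀ i, Continuous fun θ => G i (gam r θ) := fun i => (hG i).comp (gam_cont_r r)
  rw [intervalIntegral.integral_finsetSum (fun i _ => (hcompi i).intervalIntegrable _ _)] at hH
  refine le_trans ?_ hH
  calc (2 / r) * |∑ i, ∫ x in ball (0:E2) r, (pd 0 (a i) x * pd 1 (b i) x - pd 0 (b i) x * pd 1 (a i) x)|
      ≤ (2 / r) * ∑ i, (r^2/2 * ∫ θ in (-π)..π, G i (gam r θ)) := by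
        gcongr
        refine (Finset.abs_sum_le_sum_abs _ _).trans (Finset.sum_le_sum fun i _ => ?_)
        exact scalar_bound (ha i) (hb i) hr0
    _ = _ := by
        rw [← Finset.mul_sum]
        field_simp
end
end

section
/- Let 0<Δ<1. For every y ∈ C²(cl(B₁); ℝ³) and every Φ ∈ C²_c(B₁; ℝ), ∫_{B₁} (Σ_{i=1}^{3} det D²y_i) Φ dL² − πΔ² Φ(0) = −(1/2) ∫_{B₁} (g_y − g_Δ) : cof D²Φ dL², where cof D²Φ = [[Φ_{,22}, −Φ_{,12}],[−Φ_{,12}, Φ_{,11}]] and A:B denotes the sum of entrywise products of 2×2 matrices. -/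
open MeasureTheory Metric Real Filter Matrix
open scoped ENNReal Topology

noncomputable section

/-- Cofactor matrix of the Hessian of a `C²` function (`Φ_{,12} = Φ_{,21}`). -/
def cof2 (A : Matrix (Fin 2) (Fin 2) ℝ) : Matrix (Fin 2) (Fin 2) ℝ :=
  !![A 1 1, -A 0 1; -A 0 1, A 0 0]

/-- Entrywise dot product `A : B` of two `2×2` matrices. -/
def mdot (A B : Matrix (Fin 2) (Fin 2) ℝ) : ℝ := ∑ i, ∑ j, A i j * B i j

lemma pd_contDiff {n : ℕ} {f : E2 → ℝ} (hf : ContDiff ℝ (n+1) f) (i : Fin 2) :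
    ContDiff ℝ n (pd i f) := by
  unfold pd
  exact (hf.fderiv_right (m := n) le_rfl).clm_apply contDiff_const

lemma pd_cpt {f : E2 → ℝ} (hf : HasCompactSupport f) (i : Fin 2) :
    HasCompactSupport (pd i f) := hf.fderiv_apply ℝ (e2 i)

lemma pd_mul {f g : E2 → ℝ} (hf : ContDiff ℝ 1 f) (hg : ContDiff ℝ 1 g) (i : Fin 2) (x : E2) :
    pd i (fun z => f z * g z) x = pd i f x * g x + f x * pd i g x := by
  unfold pd
  rw [fderiv_fun_mul (hf.differentiable (by simp) x) (hg.differentiable (by simp) x)]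
  simp; ring

lemma pd_symm {f : E2 → ℝ} (hf : ContDiff ℝ 2 f) (x : E2) (i j : Fin 2) :
    pd i (pd j f) x = pd j (pd i f) x := by
  have h := (hf.contDiffAt (x := x)).isSymmSndFDerivAt (by simp)
  have h2 : ∀ v w : E2, fderiv ℝ (fun z => fderiv ℝ f z v) x w = fderiv ℝ (fderiv ℝ f) x w v := by
    intro v w
    have hd : DifferentiableAt ℝ (fderiv ℝ f) x :=
      (hf.fderiv_right (m := 1) (by norm_num)).differentiable (by simp) x
    rw [fderiv_clm_apply hd (by fun_prop)]
    simp
  unfold pd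
  rw [h2, h2]
  exact h.eq _ _

lemma cont1 {f : E2 → ℝ} (hf : ContDiff ℝ 1 f) (i : Fin 2) : Continuous (pd i f) :=
  (pd_contDiff (n := 0) (by simpa using hf) i).continuous

lemma int_pd {u : E2 → ℝ} (hu : ContDiff ℝ 1 u) (hc : HasCompactSupport u) (i : Fin 2) :
    ∫ x, pd i u x = 0 := by
  have h := integral_mul_fderiv_eq_neg_fderiv_mul_of_integrable (𝕜 := ℝ) (μ := (volume : Measure E2))
    (f := fun _ : E2 => (1:ℝ)) (g := u) (v := e2 i) (by simp)
    (by simp only [one_mul]; exact (cont1 hu i).integrable_of_hasCompactSupport (pd_cpt hc i))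
    (by simpa using hu.continuous.integrable_of_hasCompactSupport hc)
    (by fun_prop) (fun x _ => hu.differentiable (by simp) x)
  simpa [pd] using h

lemma int_cross {w v : E2 → ℝ} (hw : ContDiff ℝ 1 w) (hwc : HasCompactSupport w)
    (hv : ContDiff ℝ 1 v) (hvc : HasCompactSupport v) :
    ∫ x, pd 0 w x * pd 1 v x = ∫ x, pd 1 w x * pd 0 v x := by
  obtain ⟨C, hC⟩ := hw.lipschitzWith_of_hasCompactSupport hwc (by simp)
  obtain ⟨D, hD⟩ := hv.lipschitzWith_of_hasCompactSupport hvc (by simp)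
  have hline : ∀ {f : E2 → ℝ}, ContDiff ℝ 1 f → ∀ x z, lineDeriv ℝ f x z = fderiv ℝ f x z :=
    fun hf x z => (hf.differentiable (by simp) x).lineDeriv_eq_fderiv
  have iw := fun i => (cont1 hw i).integrable_of_hasCompactSupport (pd_cpt hwc i) (μ := volume)
  have iv := fun i => (cont1 hv i).integrable_of_hasCompactSupport (pd_cpt hvc i) (μ := volume)
  have T1 := hD.integral_inv_smul_sub_mul_tendsto_integral_lineDeriv_mul (iw 0) (e2 1)
  have T2 := hC.integral_inv_smul_sub_mul_tendsto_integral_lineDeriv_mul (iv 0) (-e2 1)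
  have hS : ∀ t : ℝ, ∫ x, (t⁻¹ • (v (x + t • e2 1) - v x)) * pd 0 w x
     = - ∫ x, (t⁻¹ • (w (x + t • -e2 1) - w x)) * pd 0 v x := by
    intro t
    have hsh : ContDiff ℝ 1 (fun x : E2 => v (x + t • e2 1)) := hv.comp (by fun_prop)
    have hpsh : ∀ x, pd 0 (fun x : E2 => v (x + t • e2 1)) x = pd 0 v (x + t • e2 1) := by
      intro x; unfold pd; rw [fderiv_comp_add_right]
    have e1 : ∫ x, pd 0 (fun z => v (z + t • e2 1) * w z) x = 0 :=
      int_pd (hsh.mul hw) hwc.mul_left 0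
    have e2' : ∫ x, pd 0 (fun z => v z * w z) x = 0 := int_pd (hv.mul hw) hwc.mul_left 0
    simp only [pd_mul hsh hw, pd_mul hv hw, hpsh] at e1 e2'
    have c0v := cont1 hv 0
    have c0w := cont1 hw 0
    have cv := hv.continuous
    have cw := hw.continuous
    have I1 : Integrable (fun x => pd 0 v (x + t • e2 1) * w x) :=
      (Continuous.integrable_of_hasCompactSupport (by fun_prop) hwc.mul_left)
    have I2 : Integrable (fun x => v (x + t • e2 1) * pd 0 w x) :=
      (Continuous.integrable_of_hasCompactSupport (by fun_prop) (pd_cpt hwc 0).mul_left)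
    have I3 : Integrable (fun x => pd 0 v x * w x) :=
      (Continuous.integrable_of_hasCompactSupport (by fun_prop) hwc.mul_left)
    have I4 : Integrable (fun x => v x * pd 0 w x) :=
      (Continuous.integrable_of_hasCompactSupport (by fun_prop) (pd_cpt hwc 0).mul_left)
    have I5 : Integrable (fun x => pd 0 v x * w (x + t • -e2 1)) :=
      (Continuous.integrable_of_hasCompactSupport (by fun_prop) (pd_cpt hvc 0).mul_right)
    have e3 : ∫ x, pd 0 v (x + t • e2 1) * w x = ∫ x, pd 0 v x * w (x + t • -e2 1) := by
      rw [← integral_add_right_eq_self (fun x => pd 0 v x * w (x + t • -e2 1)) (t • e2 1)]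
      congr 1; ext x; congr 2; simp
    rw [integral_add I1 I2, e3] at e1
    rw [integral_add I3 I4] at e2'
    have l : ∀ x, (t⁻¹ • (v (x + t • e2 1) - v x)) * pd 0 w x
       = t⁻¹ * (v (x + t • e2 1) * pd 0 w x - v x * pd 0 w x) := by
      intro x; simp; ring
    have r : ∀ x, (t⁻¹ • (w (x + t • -e2 1) - w x)) * pd 0 v x
       = t⁻¹ * (pd 0 v x * w (x + t • -e2 1) - pd 0 v x * w x) := by
      intro x; simp; ring
    simp only [l, r]
    rw [integral_const_mul, integral_const_mul, integral_sub I2 I4, integral_sub I5 I3]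
    linear_combination t⁻¹ * (e1 - e2')
  simp only [hS] at T1
  have := tendsto_nhds_unique T1 T2.neg
  simp only [hline hw, hline hv, map_neg, neg_mul, integral_neg, neg_neg] at this
  simp only [mul_comm (pd 0 w _)]
  exact this

lemma det_part {f Φ : E2 → ℝ} (hf : ContDiff ℝ 2 f) (hfc : HasCompactSupport f)
    (hΦ : ContDiff ℝ 2 Φ) (hc : HasCompactSupport Φ) :
    ∫ x, ((hess f x).det * Φ x + 1 / 2 * (pd 0 f x * pd 0 f x * pd 1 (pd 1 Φ) x
      + pd 1 f x * pd 1 f x * pd 0 (pd 0 Φ) x - 2 * (pd 0 f x * pd 1 f x) * pd 0 (pd 1 Φ) x)) = 0 := by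
  have ca : ∀ i, ContDiff ℝ 1 (pd i f) := fun i => pd_contDiff (n := 1) (by simpa [one_add_one_eq_two] using hf) i
  have cp : ∀ i, ContDiff ℝ 1 (pd i Φ) := fun i => pd_contDiff (n := 1) (by simpa [one_add_one_eq_two] using hΦ) i
  have c1 : ContDiff ℝ 1 Φ := hΦ.of_le (by norm_num)
  have key : ∀ u : E2 → ℝ, ContDiff ℝ 1 u → HasCompactSupport u → ∀ i,
    Integrable (pd i u) := fun u hu hc i => (cont1 hu i).integrable_of_hasCompactSupport (pd_cpt hc i)
  have key3 : ∀ i j k (u : E2 → ℝ), ContDiff ℝ 1 u → HasCompactSupport u → 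
    Integrable (fun x => pd i u x * pd j (pd k f) x) := by
    intro i j k u hu huc
    exact ((cont1 hu i).mul (cont1 (ca k) j)).integrable_of_hasCompactSupport (pd_cpt huc i).mul_right
  have sA : ∀ i j k, ContDiff ℝ 1 (fun x => pd i f x * pd j f x * pd k Φ x) := fun i j k =>
    ((ca i).mul (ca j)).mul (cp k)
  have kA : ∀ i j k, HasCompactSupport (fun x => pd i f x * pd j f x * pd k Φ x) := fun i j k =>
    (pd_cpt hc k).mul_left
  have sB : ∀ i, ContDiff ℝ 1 (fun x => pd i f x * Φ x) := fun i => (ca i).mul c1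
  have kB : ∀ i, HasCompactSupport (fun x => pd i f x * Φ x) := fun i => hc.mul_left
  have Z1 := int_pd (sA 0 0 1) (kA 0 0 1) 1
  have Z2 := int_pd (sA 1 1 0) (kA 1 1 0) 0
  have Z3 := int_pd (sA 0 1 1) (kA 0 1 1) 0
  have Z4 := int_pd (sA 0 1 0) (kA 0 1 0) 1
  have Z5 := int_cross (sB 0) (kB 0) (ca 1) (pd_cpt hfc 1)
  have Z6 := int_cross (sB 1) (kB 1) (ca 0) (pd_cpt hfc 0)
  have J1 := key _ (sA 0 0 1) (kA 0 0 1) 1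
  have J2 := key _ (sA 1 1 0) (kA 1 1 0) 0
  have J3 := key _ (sA 0 1 1) (kA 0 1 1) 0
  have J4 := key _ (sA 0 1 0) (kA 0 1 0) 1
  have J5 := key3 0 1 1 _ (sB 0) (kB 0)
  have J5' := key3 1 0 1 _ (sB 0) (kB 0)
  have J6 := key3 0 1 0 _ (sB 1) (kB 1)
  have J6' := key3 1 0 0 _ (sB 1) (kB 1)
  have E : ∀ x, ((hess f x).det * Φ x + 1 / 2 * (pd 0 f x * pd 0 f x * pd 1 (pd 1 Φ) x
      + pd 1 f x * pd 1 f x * pd 0 (pd 0 Φ) x - 2 * (pd 0 f x * pd 1 f x) * pd 0 (pd 1 Φ) x))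
      = 1/2 * (((((((pd 1 (fun x => pd 0 f x * pd 0 f x * pd 1 Φ x) x
        + pd 0 (fun x => pd 1 f x * pd 1 f x * pd 0 Φ x) x)
        - pd 0 (fun x => pd 0 f x * pd 1 f x * pd 1 Φ x) x)
        - pd 1 (fun x => pd 0 f x * pd 1 f x * pd 0 Φ x) x)
        + pd 0 (fun x => pd 0 f x * Φ x) x * pd 1 (pd 1 f) x)
        - pd 1 (fun x => pd 0 f x * Φ x) x * pd 0 (pd 1 f) x)
        + pd 1 (fun x => pd 1 f x * Φ x) x * pd 0 (pd 0 f) x)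
        - pd 0 (fun x => pd 1 f x * Φ x) x * pd 1 (pd 0 f) x) := by
    intro x
    have s1 := pd_symm hf x 1 0
    have s2 := pd_symm hΦ x 1 0
    rw [pd_mul ((ca _).mul (ca _)) (cp _), pd_mul ((ca _).mul (ca _)) (cp _),
      pd_mul ((ca _).mul (ca _)) (cp _), pd_mul ((ca _).mul (ca _)) (cp _)]
    simp only [pd_mul (ca _) (ca _), pd_mul (ca _) c1, hess, Matrix.det_fin_two, Matrix.of_apply, s1, s2]
    ring
  simp only [E]
  rw [integral_const_mul, integral_sub, integral_add, integral_sub, integral_add, integral_sub,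
    integral_sub, integral_add, Z1, Z2, Z3, Z4, Z5, Z6]
  · ring
  all_goals first | assumption | skip
  · exact J1.add J2
  · exact (J1.add J2).sub J3
  · exact ((J1.add J2).sub J3).sub J4
  · exact (((J1.add J2).sub J3).sub J4).add J5
  · exact ((((J1.add J2).sub J3).sub J4).add J5).sub J5'
  · exact (((((J1.add J2).sub J3).sub J4).add J5).sub J5').add J6'

lemma pd_tsupp (f : E2 → ℝ) (i : Fin 2) : tsupport (pd i f) ⊆ tsupport f :=
  tsupport_fderiv_apply_subset ℝ (e2 i)

/-- unit vector at angle θ -/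
def omg (θ : ℝ) : E2 := cos θ • e2 0 + sin θ • e2 1

lemma omg_zero (θ : ℝ) : omg θ 0 = cos θ := by simp [omg, e2]
lemma omg_one (θ : ℝ) : omg θ 1 = sin θ := by simp [omg, e2]
lemma norm_omg (θ : ℝ) : ‖omg θ‖ = 1 := by
  rw [EuclideanSpace.norm_eq]
  simp [omg_zero, omg_one]
lemma cont_omg : Continuous omg := by unfold omg; fun_prop

lemma deriv_ray {f : E2 → ℝ} (hf : ContDiff ℝ 1 f) (θ r : ℝ) :
    HasDerivAt (fun r : ℝ => f (r • omg θ))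
      (cos θ * pd 0 f (r • omg θ) + sin θ * pd 1 f (r • omg θ)) r := by
  have h1 : HasDerivAt (fun r : ℝ => r • omg θ) (omg θ) r := by
    simpa using (hasDerivAt_id r).smul_const (omg θ)
  have h2 := (hf.differentiable (by simp) (r • omg θ)).hasFDerivAt.comp_hasDerivAt r h1
  refine h2.congr_deriv ?_
  conv_lhs => arg 2; rw [omg]
  simp [pd]

lemma int_E2 (F : E2 → ℝ) : ∫ x, F x =
    ∫ p in polarCoord.target, p.1 * F (p.1 • omg p.2) := by
  have h1 : ∫ x, F x = ∫ p : ℝ × ℝ, F (WithLp.toLp 2 ![p.1, p.2]) := by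
    rw [← (PiLp.volume_preserving_toLp (Fin 2)).integral_comp
      (MeasurableEquiv.toLp 2 (Fin 2 → ℝ)).measurableEmbedding,
      ← ((volume_preserving_finTwoArrow ℝ).symm _).integral_comp
        (MeasurableEquiv.finTwoArrow.symm).measurableEmbedding]
    rfl
  rw [h1, ← integral_comp_polarCoord_symm]
  congr 1; ext p
  simp only [smul_eq_mul, polarCoord_symm_apply]
  congr 2
  ext i
  fin_cases i <;> simp [omg_zero, omg_one]

lemma radial {Φ : E2 → ℝ} (hΦ : ContDiff ℝ 2 Φ) (hsub : tsupport Φ ⊆ ball (0 : E2) 1) :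
    ∫ x : E2, (x 0 ^ 2 * pd 0 (pd 0 Φ) x + 2 * (x 0 * x 1) * pd 0 (pd 1 Φ) x
      + x 1 ^ 2 * pd 1 (pd 1 Φ) x) / ‖x‖ ^ 2 = 2 * π * Φ 0 := by
  have cp : ∀ i, ContDiff ℝ 1 (pd i Φ) := fun i => pd_contDiff (n := 1) (by simpa [one_add_one_eq_two] using hΦ) i
  have c1 : ContDiff ℝ 1 Φ := hΦ.of_le (by norm_num)
  have cc : ∀ i j, Continuous (pd i (pd j Φ)) := fun i j => cont1 (cp j) i
  have co := cont_omg
  have z : ∀ f : E2 → ℝ, tsupport f ⊆ tsupport Φ → ∀ θ r : ℝ, 1 ≤ r → f (r • omg θ) = 0 := by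
    intro f hf θ r hr
    apply image_eq_zero_of_notMem_tsupport
    intro h
    have := hsub (hf h)
    rw [mem_ball_zero_iff, norm_smul, norm_omg, Real.norm_eq_abs, abs_of_nonneg (by linarith)] at this
    linarith
  have z2 : ∀ i j, ∀ θ r : ℝ, 1 ≤ r → pd i (pd j Φ) (r • omg θ) = 0 := fun i j =>
    z _ ((pd_tsupp _ _).trans (pd_tsupp _ _))
  have z1 : ∀ j, ∀ θ r : ℝ, 1 ≤ r → pd j Φ (r • omg θ) = 0 := fun j => z _ (pd_tsupp _ _)
  have z0 : ∀ θ r : ℝ, 1 ≤ r → Φ (r • omg θ) = 0 := z _ le_rfl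
  set G : ℝ × ℝ → ℝ := fun p => p.1 * (cos p.2 * (cos p.2 * pd 0 (pd 0 Φ) (p.1 • omg p.2)
      + sin p.2 * pd 1 (pd 0 Φ) (p.1 • omg p.2)) + sin p.2 * (cos p.2 * pd 0 (pd 1 Φ) (p.1 • omg p.2)
      + sin p.2 * pd 1 (pd 1 Φ) (p.1 • omg p.2))) with hG
  have Gc : Continuous G := by
    have := cc 0 0; have := cc 0 1; have := cc 1 0; have := cc 1 1
    fun_prop
  have Gz : ∀ p : ℝ × ℝ, 1 ≤ p.1 → G p = 0 := by
    intro p hp; simp [hG, z2 _ _ _ _ hp]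
  have Gi : IntegrableOn G (Set.Ioi (0:ℝ) ×ˢ Set.Ioo (-π) π) := by
    have hK : IntegrableOn G (Set.Icc (0:ℝ) 1 ×ˢ Set.Icc (-π) π) :=
      Gc.continuousOn.integrableOn_compact (isCompact_Icc.prod isCompact_Icc)
    refine hK.of_forall_sdiff_eq_zero (measurableSet_Ioi.prod measurableSet_Ioo) ?_
    rintro ⟨r, θ⟩ ⟨⟨h1, h2⟩, h3⟩
    apply Gz
    by_contra hlt
    simp only [Set.mem_Ioi, Set.mem_Ioo, Set.mem_prod, Set.mem_Icc] at *
    apply h3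
    refine ⟨⟨?_, ?_⟩, ?_, ?_⟩ <;> linarith
  rw [int_E2]
  have e : ∫ p in polarCoord.target, p.1 * (((p.1 • omg p.2) 0 ^ 2 * pd 0 (pd 0 Φ) (p.1 • omg p.2)
      + 2 * ((p.1 • omg p.2) 0 * (p.1 • omg p.2) 1) * pd 0 (pd 1 Φ) (p.1 • omg p.2)
      + (p.1 • omg p.2) 1 ^ 2 * pd 1 (pd 1 Φ) (p.1 • omg p.2)) / ‖p.1 • omg p.2‖ ^ 2)
      = ∫ p in Set.Ioi (0:ℝ) ×ˢ Set.Ioo (-π) π, G p := by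
    rw [polarCoord_target]
    refine setIntegral_congr_fun (measurableSet_Ioi.prod measurableSet_Ioo) ?_
    rintro ⟨r, θ⟩ ⟨h1, h2⟩
    have hr : r ≠ 0 := ne_of_gt h1
    simp only [hG, norm_smul, norm_omg, PiLp.smul_apply, omg_zero, omg_one, smul_eq_mul, mul_one,
      Real.norm_eq_abs, sq_abs]
    rw [pd_symm hΦ _ 1 0]
    field_simp
    ring
  rw [e]
  rw [Measure.volume_eq_prod] at Gi ⊢
  rw [← Measure.prod_restrict, integral_prod_symm]
  swap
  · rw [Measure.prod_restrict]; exact Gi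
  have inner : ∀ θ : ℝ, ∫ r in Set.Ioi (0:ℝ), G (r, θ) = Φ 0 := by
    intro θ
    have hd : ∀ r ∈ Set.Ici (0:ℝ), HasDerivAt (fun r : ℝ => r * (cos θ * pd 0 Φ (r • omg θ)
        + sin θ * pd 1 Φ (r • omg θ)) - Φ (r • omg θ)) (G (r, θ)) r := by
      intro r _
      have := ((hasDerivAt_id r).mul (((deriv_ray (cp 0) θ r).const_mul (cos θ)).add
        ((deriv_ray (cp 1) θ r).const_mul (sin θ)))).sub (deriv_ray c1 θ r)
      refine this.congr_deriv ?_
      simp [hG]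
    have := integral_Ioi_of_hasDerivAt_of_tendsto' (m := 0) hd ?_ ?_
    · rw [this]; simp
    · have hK : IntegrableOn (fun r => G (r, θ)) (Set.Icc (0:ℝ) 1) :=
        (Continuous.continuousOn (by fun_prop)).integrableOn_compact isCompact_Icc
      refine hK.of_forall_sdiff_eq_zero measurableSet_Ioi ?_
      rintro r ⟨h1, h3⟩
      apply Gz
      by_contra hlt
      exact h3 ⟨le_of_lt h1, by simpa using le_of_lt (not_le.mp hlt)⟩
    · refine tendsto_const_nhds.congr' ?_
      filter_upwards [eventually_ge_atTop 1] with r hr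
      simp [z1 _ _ _ hr, z0 _ _ hr]
  simp only [inner]
  simp [Real.pi_pos.le]
  left; ring

/-- weak formulation of the excess Hessian determinant in terms of
the membrane strain tested against the cofactor matrix of `D²Φ`. -/
theorem stmt_8 (Δ : ℝ) (hΔ0 : 0 < Δ) (hΔ1 : Δ < 1) (y : E2 → E3) (hy : ContDiff ℝ 2 y)
    (Φ : E2 → ℝ) (hΦ : ContDiff ℝ 2 Φ) (hsupp : HasCompactSupport Φ)
    (hsub : tsupport Φ ⊆ ball (0 : E2) 1) :
    (∫ x in ball (0 : E2) 1, (∑ i : Fin 3, (hess (fun z => y z i) x).det) * Φ x)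
        - π * Δ ^ 2 * Φ 0
      = -(1 / 2) *
          ∫ x in ball (0 : E2) 1, mdot (gmet y x - gDelta Δ x) (cof2 (hess Φ x)) := by
  have cp : ∀ i, ContDiff ℝ 1 (pd i Φ) := fun i => pd_contDiff (n := 1) (by simpa [one_add_one_eq_two] using hΦ) i
  have cc : ∀ i j, Continuous (pd i (pd j Φ)) := fun i j => cont1 (cp j) i
  have kc : ∀ i j, HasCompactSupport (pd i (pd j Φ)) := fun i j => pd_cpt (pd_cpt hsupp j) i
  have zz : ∀ i j, ∀ x, x ∉ ball (0 : E2) 1 → pd i (pd j Φ) x = 0 := fun i j x hx =>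
    image_eq_zero_of_notMem_tsupport
      (fun h => hx (hsub (((pd_tsupp _ _).trans (pd_tsupp _ _)) h)))
  have z0 : ∀ x, x ∉ ball (0 : E2) 1 → Φ x = 0 := fun x hx =>
    image_eq_zero_of_notMem_tsupport (fun h => hx (hsub h))
  let χ : ContDiffBump (0 : E2) := ⟨1, 2, by norm_num, by norm_num⟩
  let f : Fin 3 → E2 → ℝ := fun i z => χ z * y z i
  have hyi : ∀ i, ContDiff ℝ 2 (fun z => y z i) := fun i => by
    exact (contDiff_euclidean.mp hy) i
  have hf : ∀ i, ContDiff ℝ 2 (f i) := fun i => χ.contDiff.mul (hyi i)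
  have hfc : ∀ i, HasCompactSupport (f i) := fun i => χ.hasCompactSupport.mul_right
  have ca : ∀ k i, ContDiff ℝ 1 (pd i (f k)) := fun k i => pd_contDiff (n := 1) (by simpa [one_add_one_eq_two] using hf k) i
  have ev : ∀ i, ∀ x ∈ ball (0 : E2) 1, (fun z => y z i) =ᶠ[𝓝 x] f i := by
    intro i x hx
    filter_upwards [isOpen_ball.mem_nhds hx] with z hz
    have : χ z = 1 := χ.one_of_mem_closedBall (ball_subset_closedBall hz)
    simp [f, this]
  have evp : ∀ j i, ∀ x ∈ ball (0 : E2) 1, pd j (fun z => y z i) =ᶠ[𝓝 x] pd j (f i) := by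
    intro j i x hx
    filter_upwards [(ev i x hx).fderiv (𝕜 := ℝ)] with z hz
    simp only [pd, hz]
  have hpp : ∀ k j i, ∀ x ∈ ball (0 : E2) 1,
      pd k (pd j (fun z => y z i)) x = pd k (pd j (f i)) x := by
    intro k j i x hx
    have := (evp j i x hx).fderiv_eq (𝕜 := ℝ)
    unfold pd at this ⊢
    rw [this]
  have hhess : ∀ i, ∀ x ∈ ball (0 : E2) 1, hess (fun z => y z i) x = hess (f i) x := by
    intro i x hx
    ext a b
    simp only [hess, Matrix.of_apply, hpp a b i x hx]
  let P : Fin 3 → E2 → ℝ := fun i x => pd 0 (f i) x * pd 0 (f i) x * pd 1 (pd 1 Φ) x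
      + pd 1 (f i) x * pd 1 (f i) x * pd 0 (pd 0 Φ) x
      - 2 * (pd 0 (f i) x * pd 1 (f i) x) * pd 0 (pd 1 Φ) x
  let Q : Fin 3 → E2 → ℝ := fun i x => (hess (f i) x).det * Φ x
  let F : E2 → ℝ := fun x => (x 0 ^ 2 * pd 0 (pd 0 Φ) x + 2 * (x 0 * x 1) * pd 0 (pd 1 Φ) x
      + x 1 ^ 2 * pd 1 (pd 1 Φ) x) / ‖x‖ ^ 2
  have iP : ∀ i, Integrable (P i) := by
    intro i
    have a0 := (ca i 0).continuous
    have a1 := (ca i 1).continuous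
    refine Integrable.sub (Integrable.add ?_ ?_) ?_
    · exact Continuous.integrable_of_hasCompactSupport ((a0.mul a0).mul (cc 1 1)) (kc 1 1).mul_left
    · exact Continuous.integrable_of_hasCompactSupport ((a1.mul a1).mul (cc 0 0)) (kc 0 0).mul_left
    · exact Continuous.integrable_of_hasCompactSupport
        ((continuous_const.mul (a0.mul a1)).mul (cc 0 1)) (kc 0 1).mul_left
  have iQ : ∀ i, Integrable (Q i) := by
    intro i
    have b := fun k j => cont1 (ca i j) k
    refine Continuous.integrable_of_hasCompactSupport (f := fun x => (hess (f i) x).det * Φ x) ?_ hsupp.mul_left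
    have e : ∀ x, (hess (f i) x).det = pd 0 (pd 0 (f i)) x * pd 1 (pd 1 (f i)) x
        - pd 0 (pd 1 (f i)) x * pd 1 (pd 0 (f i)) x := fun x => by
      simp [hess, Matrix.det_fin_two]
    simp only [e]
    exact (((b 0 0).mul (b 1 1)).sub ((b 0 1).mul (b 1 0))).mul hΦ.continuous
  have iH : ∀ i j, Integrable (pd i (pd j Φ)) := fun i j =>
    (cc i j).integrable_of_hasCompactSupport (kc i j)
  have bd : ∀ (i j : Fin 2) (x : E2), ‖x i * x j / ‖x‖ ^ 2‖ ≤ 1 := by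
    intro i j x
    have h1 : ‖x i‖ ≤ ‖x‖ := PiLp.norm_apply_le x i
    have h2 : ‖x j‖ ≤ ‖x‖ := PiLp.norm_apply_le x j
    rw [norm_div, norm_mul, norm_pow, norm_norm]
    refine div_le_one_of_le₀ ?_ (by positivity)
    rw [sq]
    exact mul_le_mul h1 h2 (norm_nonneg _) (norm_nonneg _)
  have iW : ∀ i j k l, Integrable (fun x : E2 => x i * x j / ‖x‖ ^ 2 * pd k (pd l Φ) x) := by
    intro i j k l
    refine (iH k l).bdd_mul (c := 1) ?_ (Eventually.of_forall (bd i j))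
    refine Measurable.aestronglyMeasurable ?_
    refine Measurable.div (Continuous.measurable (by fun_prop)) (Continuous.measurable (by fun_prop))
  have iF : Integrable F := by
    have := ((iW 0 0 0 0).add ((iW 0 1 0 1).const_mul 2)).add (iW 1 1 1 1)
    refine this.congr (Eventually.of_forall fun x => ?_)
    simp only [F, Pi.add_apply]
    ring
  have L : ∫ x in ball (0 : E2) 1, (∑ i : Fin 3, (hess (fun z => y z i) x).det) * Φ x
      = ∑ i, ∫ x, Q i x := by
    rw [← integral_finsetSum _ (fun i _ => iQ i)]
    rw [← setIntegral_eq_integral_of_forall_compl_eq_zero (s := ball (0 : E2) 1)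
      (f := fun x => ∑ i, Q i x)]
    · refine setIntegral_congr_fun measurableSet_ball fun x hx => ?_
      simp only [hhess _ x hx, Q, Finset.sum_mul]
    · intro x hx
      simp [Q, z0 x hx]
  have R : ∫ x in ball (0 : E2) 1, mdot (gmet y x - gDelta Δ x) (cof2 (hess Φ x))
      = ∫ x, (((∑ i, P i x) - (pd 0 (pd 0 Φ) x + pd 1 (pd 1 Φ) x)) + Δ ^ 2 * F x) := by
    rw [← setIntegral_eq_integral_of_forall_compl_eq_zero (s := ball (0 : E2) 1)
      (f := fun x => (((∑ i, P i x) - (pd 0 (pd 0 Φ) x + pd 1 (pd 1 Φ) x)) + Δ ^ 2 * F x))]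
    · refine setIntegral_congr_fun measurableSet_ball fun x hx => ?_
      simp only [mdot, gmet, gDelta, cof2, hess, Dmat, perpVec, Fin.sum_univ_two, Matrix.sub_apply,
        Matrix.mul_apply, Matrix.transpose_apply, Matrix.of_apply, (evp _ _ x hx).eq_of_nhds,
        Fin.sum_univ_three, P, F]
      simp
      ring
    · intro x hx
      simp [P, F, zz _ _ x hx]
  have hPQ : ∀ i, ∫ x, Q i x = -(1/2) * ∫ x, P i x := by
    intro i
    have h : ∫ x, (Q i x + 1 / 2 * P i x) = 0 := det_part (hf i) (hfc i) hΦ hsupp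
    rw [integral_add (iQ i) ((iP i).const_mul _), integral_const_mul] at h
    linarith
  have hF : ∫ x, F x = 2 * π * Φ 0 := radial hΦ hsub
  have h0 := int_pd (cp 0) (pd_cpt hsupp 0) 0
  have h1 := int_pd (cp 1) (pd_cpt hsupp 1) 1
  have iS : Integrable (fun x => ∑ i, P i x) := integrable_finsetSum _ (fun i _ => iP i)
  have iL : Integrable (fun x => pd 0 (pd 0 Φ) x + pd 1 (pd 1 Φ) x) := (iH 0 0).add (iH 1 1)
  have iSL : Integrable (fun x => (∑ i, P i x) - (pd 0 (pd 0 Φ) x + pd 1 (pd 1 Φ) x)) := iS.sub iL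
  rw [L, R, integral_add iSL (iF.const_mul _), integral_sub iS iL,
    integral_finsetSum _ (fun i _ => iP i), integral_add (iH 0 0) (iH 1 1), integral_const_mul,
    h0, h1, hF]
  simp only [hPQ, ← Finset.mul_sum]
  ring
end
end
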